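/- arXiv:2410.21544 — 3 statements merged into one kernel-verified Lean document; each statement's English description precedes it below -/
import Mathlib

section
/- Let U ⊆ ℝ^n be open, let ζ_1,…,ζ_m : U → ℂ be differentiable functions, and suppose that at every θ ∈ U all the quantities sin((θ_j−θ_k)/2) (j ≠ k), sin((ζ_s(θ)−ζ_t(θ))/2) (s ≠ t) and sin((θ_k−ζ_l(θ))/2) are nonzero and the angular stationary relations hold: Σ_{j=1}^n cot((ζ_s(θ)−θ_j)/2) = 2 Σ_{t≠s} cot((ζ_s(θ)−ζ_t(θ))/2) for every s. Define Z(θ) = ∏_{1≤j<k≤n} sin((θ_j−θ_k)/2)^2 · ∏_{1≤s<t≤m} sin((ζ_s(θ)−ζ_t(θ))/2)^8 · ∏_{k=1}^n∏_{l=1}^m sin((θ_k−ζ_l(θ))/2)^{−4}. Then for every j = 1,…,n and every θ ∈ U, the partial derivative ∂Z/∂θ_j(θ) exists and equals U_j(θ)·Z(θ), where U_j(θ) = Σ_{k≠j} cot((θ_j−θ_k)/2) − 2 Σ_{l=1}^m cot((θ_j−ζ_l(θ))/2). -/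
open Finset

/-- The complex cotangent. -/
noncomputable def ccot (w : ℂ) : ℂ := Complex.cos w / Complex.sin w

/-- The partition function `Z(θ)` of the multiple radial SLE(0) system in angular
coordinates, where the screening charges `ζ_l` are functions of `θ`. -/
noncomputable def Zf (n m : ℕ) (ζ : Fin m → (Fin n → ℝ) → ℂ) (θ : Fin n → ℝ) : ℂ :=
  (∏ j, ∏ k ∈ univ.filter (fun k => j < k),
      Complex.sin (((θ j : ℂ) - (θ k : ℂ)) / 2) ^ 2) *
  (∏ s, ∏ t ∈ univ.filter (fun t => s < t),
      Complex.sin ((ζ s θ - ζ t θ) / 2) ^ 8) *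
  (∏ k, ∏ l, Complex.sin (((θ k : ℂ) - ζ l θ) / 2) ^ (-4 : ℤ))

theorem hasDerivAt_finset_prod_of_logDeriv {ι : Type*} (u : Finset ι) {f : ι → ℝ → ℂ}
    {L : ι → ℂ} {x : ℝ} (h : ∀ i ∈ u, HasDerivAt (f i) (L i * f i x) x) :
    HasDerivAt (fun y => ∏ i ∈ u, f i y) ((∑ i ∈ u, L i) * ∏ i ∈ u, f i x) x := by
  classical
  induction u using Finset.induction_on with
  | empty => simpa using hasDerivAt_const x (1 : ℂ)
  | insert a u ha ih =>
    have hu := ih fun i hi => h i (mem_insert_of_mem hi)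
    have ha' := h a (mem_insert_self a u)
    simp only [prod_insert ha, sum_insert ha]
    refine (ha'.mul hu).congr_deriv ?_
    ring

theorem hasDerivAt_sin_half_sub_zpow {f g : ℝ → ℂ} {f' g' : ℂ} {x : ℝ}
    (hf : HasDerivAt f f' x) (hg : HasDerivAt g g' x)
    (hne : Complex.sin ((f x - g x) / 2) ≠ 0) (p : ℤ) :
    HasDerivAt (fun y => Complex.sin ((f y - g y) / 2) ^ p)
      ((p : ℂ) / 2 * ccot ((f x - g x) / 2) * (f' - g') *
        Complex.sin ((f x - g x) / 2) ^ p) x := by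
  have hs : HasDerivAt (fun y => Complex.sin ((f y - g y) / 2))
      (Complex.cos ((f x - g x) / 2) * ((f' - g') / 2)) x :=
    (Complex.hasDerivAt_sin _).comp x ((hf.sub hg).div_const 2)
  refine ((hasDerivAt_zpow p _ (Or.inl hne)).comp x hs).congr_deriv ?_
  rw [zpow_sub_one₀ hne, ccot]
  field_simp

theorem ccot_half_sub_comm (a b : ℂ) : ccot ((a - b) / 2) = -ccot ((b - a) / 2) := by
  rw [show (a - b) / 2 = -((b - a) / 2) by ring, ccot, ccot, Complex.cos_neg, Complex.sin_neg,
    div_neg]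

theorem sum_lt_antisymm_mul_sub {N : ℕ} (c : Fin N → Fin N → ℂ) (hc : ∀ a b, c a b = -c b a)
    (v : Fin N → ℂ) :
    ∑ a, ∑ b ∈ univ.filter (fun b => a < b), c a b * (v a - v b) =
      ∑ a, v a * ∑ b ∈ univ.filter (fun b => b ≠ a), c a b := by
  have hswap : ∑ a, ∑ b ∈ univ.filter (fun b => a < b), c a b * v b =
      -∑ a, ∑ b ∈ univ.filter (fun b => b < a), v a * c a b := by
    simp only [sum_filter]
    rw [sum_comm, ← sum_neg_distrib]
    refine sum_congr rfl fun a _ => ?_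
    rw [← sum_neg_distrib]
    refine sum_congr rfl fun b _ => ?_
    rw [hc b a]
    split_ifs <;> ring
  simp only [mul_sub, sum_sub_distrib]
  rw [hswap, sub_neg_eq_add, ← sum_add_distrib]
  refine sum_congr rfl fun a _ => ?_
  simp only [sum_filter, mul_sum]
  rw [← sum_add_distrib]
  refine sum_congr rfl fun b _ => ?_
  rcases lt_trichotomy a b with h | h | h
  · simp [h, h.not_gt, h.ne', mul_comm]
  · simp [h]
  · simp [h, h.not_gt, h.ne]

theorem stmt4 (n m : ℕ) (hn : 1 ≤ n)
    (S : Set (Fin n → ℝ)) (hS : IsOpen S)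
    (ζ : Fin m → (Fin n → ℝ) → ℂ)
    (hdiff : ∀ l, DifferentiableOn ℝ (ζ l) S)
    (h1 : ∀ θ ∈ S, ∀ j k : Fin n, j ≠ k →
      Complex.sin (((θ j : ℂ) - (θ k : ℂ)) / 2) ≠ 0)
    (h2 : ∀ θ ∈ S, ∀ s t : Fin m, s ≠ t →
      Complex.sin ((ζ s θ - ζ t θ) / 2) ≠ 0)
    (h3 : ∀ θ ∈ S, ∀ (k : Fin n) (l : Fin m),
      Complex.sin (((θ k : ℂ) - ζ l θ) / 2) ≠ 0)
    (hstat : ∀ θ ∈ S, ∀ s : Fin m,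
      ∑ j, ccot ((ζ s θ - (θ j : ℂ)) / 2)
        = 2 * ∑ t ∈ univ.filter (fun t => t ≠ s), ccot ((ζ s θ - ζ t θ) / 2)) :
    ∀ j : Fin n, ∀ θ ∈ S,
      HasDerivAt (fun x : ℝ => Zf n m ζ (Function.update θ j x))
        (((∑ k ∈ univ.filter (fun k => k ≠ j), ccot (((θ j : ℂ) - (θ k : ℂ)) / 2))
            - 2 * ∑ l, ccot (((θ j : ℂ) - ζ l θ) / 2)) * Zf n m ζ θ) (θ j) := by
  intro j θ hθ
  have hcurve : HasDerivAt (Function.update θ j) (Pi.single j (1 : ℝ)) (θ j) :=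
    hasDerivAt_update θ j _
  have hself : Function.update θ j (θ j) = θ := Function.update_eq_self j θ
  have hcoord (k : Fin n) : HasDerivAt (fun x : ℝ => ((Function.update θ j x k : ℝ) : ℂ))
      (((Pi.single j 1 : Fin n → ℝ) k : ℝ) : ℂ) (θ j) :=
    ((hasDerivAt_pi.1 hcurve) k).ofReal_comp
  have hcharge (l : Fin m) : ∃ d : ℂ,
      HasDerivAt (fun x : ℝ => ζ l (Function.update θ j x)) d (θ j) := by
    have hl : DifferentiableAt ℝ (ζ l) (Function.update θ j (θ j)) := by
      rw [hself]
      exact (hdiff l).differentiableAt (hS.mem_nhds hθ)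
    exact ⟨_, hl.hasFDerivAt.comp_hasDerivAt (θ j) hcurve⟩
  choose d hd using hcharge
  set v : Fin n → ℂ := fun k => (((Pi.single j 1 : Fin n → ℝ) k : ℝ) : ℂ) with hv
  have hA := hasDerivAt_finset_prod_of_logDeriv univ fun a _ =>
    hasDerivAt_finset_prod_of_logDeriv (univ.filter fun b => a < b) fun b hb =>
      hasDerivAt_sin_half_sub_zpow (hcoord a) (hcoord b)
        (by simpa only [hself] using h1 θ hθ a b (mem_filter.1 hb).2.ne) 2
  have hB := hasDerivAt_finset_prod_of_logDeriv univ fun s _ =>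
    hasDerivAt_finset_prod_of_logDeriv (univ.filter fun t => s < t) fun t ht =>
      hasDerivAt_sin_half_sub_zpow (hd s) (hd t)
        (by simpa only [hself] using h2 θ hθ s t (mem_filter.1 ht).2.ne) 8
  have hC := hasDerivAt_finset_prod_of_logDeriv univ fun k _ =>
    hasDerivAt_finset_prod_of_logDeriv univ fun l _ =>
      hasDerivAt_sin_half_sub_zpow (hcoord k) (hd l)
        (by simpa only [hself] using h3 θ hθ k l) (-4)
  have hZ := (hA.mul hB).mul hC
  simp only [hself] at hZ
  have eA : ∑ a, ∑ b ∈ univ.filter (fun b => a < b),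
      ((2 : ℤ) : ℂ) / 2 * ccot (((θ a : ℂ) - θ b) / 2) * (v a - v b) =
      ∑ k ∈ univ.filter (fun k => k ≠ j), ccot (((θ j : ℂ) - (θ k : ℂ)) / 2) := by
    have h := sum_lt_antisymm_mul_sub (fun a b => ccot (((θ a : ℂ) - θ b) / 2))
      (fun a b => ccot_half_sub_comm _ _) v
    simp only [Int.cast_ofNat, div_self (two_ne_zero' ℂ), one_mul]
    rw [h, sum_eq_single j (by intro b _ hb; simp [hv, hb]) (by simp)]
    simp [hv]
  have eB : ∑ s, ∑ t ∈ univ.filter (fun t => s < t),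
      ((8 : ℤ) : ℂ) / 2 * ccot ((ζ s θ - ζ t θ) / 2) * (d s - d t) =
      2 * ∑ s, d s * ∑ k, ccot ((ζ s θ - (θ k : ℂ)) / 2) := by
    have h := sum_lt_antisymm_mul_sub (fun s t => ccot ((ζ s θ - ζ t θ) / 2))
      (fun a b => ccot_half_sub_comm _ _) d
    simp only [hstat θ hθ, mul_left_comm (d _) 2]
    rw [← mul_sum, ← h]
    simp only [mul_assoc, ← mul_sum]
    push_cast
    ring
  have eC : ∑ k, ∑ l, ((-4 : ℤ) : ℂ) / 2 * ccot (((θ k : ℂ) - ζ l θ) / 2) * (v k - d l) =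
      -2 * ∑ l, ccot (((θ j : ℂ) - ζ l θ) / 2) -
        2 * ∑ s, d s * ∑ k, ccot ((ζ s θ - (θ k : ℂ)) / 2) := by
    have hleft : ∑ k, ∑ l, ccot (((θ k : ℂ) - ζ l θ) / 2) * v k =
        ∑ l, ccot (((θ j : ℂ) - ζ l θ) / 2) := by
      rw [sum_eq_single j (by intro b _ hb; simp [hv, hb]) (by simp)]
      simp [hv]
    have hright : ∑ k, ∑ l, ccot (((θ k : ℂ) - ζ l θ) / 2) * d l =
        -∑ s, d s * ∑ k, ccot ((ζ s θ - (θ k : ℂ)) / 2) := by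
      rw [sum_comm, ← sum_neg_distrib]
      refine sum_congr rfl fun l _ => ?_
      rw [mul_sum, ← sum_neg_distrib]
      refine sum_congr rfl fun k _ => ?_
      rw [ccot_half_sub_comm (θ k)]
      ring
    simp only [mul_assoc, ← mul_sum]
    simp only [mul_sub, sum_sub_distrib]
    rw [hleft, hright]
    push_cast
    ring
  rw [eA, eB, eC] at hZ
  refine HasDerivAt.congr_deriv (f := fun x : ℝ => Zf n m ζ (Function.update θ j x)) hZ ?_
  simp only [Zf, Pi.mul_apply, zpow_ofNat, hself]
  ring
end

section
/- Fix κ > 0, n ≥ 1 and h ∈ ℝ. Let Z : 𝔜^n → ℝ be twice continuously differentiable on the chamber 𝔜^n = {θ ∈ ℝ^n : θ_1 < θ_2 < … < θ_n < θ_1 + 2π} and satisfy the null vector equations 𝓛_j Z = h·Z on 𝔜^n for every j = 1,…,n, where (𝓛_j Z)(θ) = (κ/2)·∂^2Z/∂θ_j^2 + Σ_{k≠j} [ cot((θ_k−θ_j)/2)·∂Z/∂θ_k − ((6−κ)/(2κ))·Z(θ)/(2 sin^2((θ_k−θ_j)/2)) ]. Let Φ(θ) = ∏_{1≤j<k≤n}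 |sin((θ_j−θ_k)/2)|^{−2/κ} and set Z̃ = Z/Φ. Then Z̃ is an eigenfunction of the Calogero–Sutherland operator: (H Z̃)(θ) = ((n·h − n(n^2−1)/(6κ))/κ)·Z̃(θ) for all θ ∈ 𝔜^n, where (H ψ)(θ) = Σ_{j=1}^n (1/2)∂^2ψ/∂θ_j^2 − (β(β−2)/16)·Σ_{1≤j<k≤n} ψ(θ)/sin^2((θ_j−θ_k)/2) with β = 8/κ. -/
open Finset

/-- The angular chamber `𝔜^n = {θ : θ_1 < θ_2 < … < θ_n < θ_1 + 2π}`. -/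
def chamber (n : ℕ) : Set (Fin n → ℝ) :=
  {θ | StrictMono θ ∧ ∀ i j : Fin n, θ i < θ j + 2 * Real.pi}

/-- Partial derivative in the `j`-th coordinate direction. -/
noncomputable def pd (n : ℕ) (j : Fin n) (ψ : (Fin n → ℝ) → ℝ) (θ : Fin n → ℝ) : ℝ :=
  fderiv ℝ ψ θ (Pi.single j 1 : Fin n → ℝ)

/-- The null vector operator `𝓛_j`. -/
noncomputable def Lop (n : ℕ) (κ : ℝ) (j : Fin n) (ψ : (Fin n → ℝ) → ℝ)
    (θ : Fin n → ℝ) : ℝ :=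
  κ / 2 * pd n j (pd n j ψ) θ
    + ∑ k ∈ univ.filter (fun k => k ≠ j),
        (Real.cos ((θ k - θ j) / 2) / Real.sin ((θ k - θ j) / 2) * pd n k ψ θ
          - (6 - κ) / (2 * κ) * ψ θ / (2 * Real.sin ((θ k - θ j) / 2) ^ 2))

/-- The function `Φ(θ) = ∏_{j<k} |sin((θ_j−θ_k)/2)|^{−2/κ}`. -/
noncomputable def PhiCS (n : ℕ) (κ : ℝ) (θ : Fin n → ℝ) : ℝ :=
  ∏ j, ∏ k ∈ univ.filter (fun k => j < k),
    |Real.sin ((θ j - θ k) / 2)| ^ (-2 / κ)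

/-- The Calogero–Sutherland operator with coupling `β`. -/
noncomputable def Hcs (n : ℕ) (β : ℝ) (ψ : (Fin n → ℝ) → ℝ) (θ : Fin n → ℝ) : ℝ :=
  (∑ j, (1 / 2) * pd n j (pd n j ψ) θ)
    - β * (β - 2) / 16 *
        ∑ j, ∑ k ∈ univ.filter (fun k => j < k),
          ψ θ / Real.sin ((θ j - θ k) / 2) ^ 2

theorem isOpen_chamber (n : ℕ) : IsOpen (chamber n) := by
  have h : chamber n = {θ | ∀ i j : Fin n, i < j → θ i < θ j} ∩
      {θ | ∀ i j : Fin n, θ i < θ j + 2 * Real.pi} := by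
    ext θ
    simp [chamber, StrictMono]
  rw [h]
  simp only [Set.ofPred_forall]
  refine IsOpen.inter ?_ ?_
  · exact isOpen_iInter_of_finite fun i => isOpen_iInter_of_finite fun j =>
      isOpen_iInter_of_finite fun _ => isOpen_lt (continuous_apply i) (continuous_apply j)
  · exact isOpen_iInter_of_finite fun i => isOpen_iInter_of_finite fun j =>
      isOpen_lt (continuous_apply i) ((continuous_apply j).add continuous_const)

theorem sin_half_sub_ne_zero {n : ℕ} {θ : Fin n → ℝ} (hθ : θ ∈ chamber n) {j k : Fin n}
    (hjk : j ≠ k) : Real.sin ((θ j - θ k) / 2) ≠ 0 := by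
  have h1 := hθ.2 j k
  have h2 := hθ.2 k j
  have h3 : θ j ≠ θ k := fun h => hjk (hθ.1.injective h)
  intro h0
  have := (Real.sin_eq_zero_iff_of_lt_of_lt (by linarith) (by linarith)).1 h0
  exact h3 (by linarith)

/-- The matrix `cot ((θ_j - θ_k) / 2)`, which vanishes on the diagonal by convention. -/
noncomputable def halfCot {n : ℕ} (θ : Fin n → ℝ) (j k : Fin n) : ℝ :=
  Real.cos ((θ j - θ k) / 2) / Real.sin ((θ j - θ k) / 2)

/-- The matrix `1 / sin² ((θ_j - θ_k) / 2)`, which vanishes on the diagonal by convention. -/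
noncomputable def invSinSq {n : ℕ} (θ : Fin n → ℝ) (j k : Fin n) : ℝ :=
  1 / Real.sin ((θ j - θ k) / 2) ^ 2

theorem halfCot_self {n : ℕ} (θ : Fin n → ℝ) (j : Fin n) : halfCot θ j j = 0 := by
  simp [halfCot]

theorem invSinSq_self {n : ℕ} (θ : Fin n → ℝ) (j : Fin n) : invSinSq θ j j = 0 := by
  simp [invSinSq]

theorem sin_half_sub_swap {n : ℕ} (θ : Fin n → ℝ) (j k : Fin n) :
    Real.sin ((θ k - θ j) / 2) = -Real.sin ((θ j - θ k) / 2) := by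
  rw [← Real.sin_neg]; ring_nf

theorem halfCot_swap {n : ℕ} (θ : Fin n → ℝ) (j k : Fin n) :
    halfCot θ k j = -halfCot θ j k := by
  have : Real.cos ((θ k - θ j) / 2) = Real.cos ((θ j - θ k) / 2) := by
    rw [← Real.cos_neg]; ring_nf
  rw [halfCot, halfCot, sin_half_sub_swap, this, div_neg]

theorem invSinSq_swap {n : ℕ} (θ : Fin n → ℝ) (j k : Fin n) :
    invSinSq θ k j = invSinSq θ j k := by
  rw [invSinSq, invSinSq, sin_half_sub_swap, neg_sq]

theorem halfCot_sq {n : ℕ} {θ : Fin n → ℝ} (hθ : θ ∈ chamber n) {j k : Fin n} (hjk : j ≠ k) :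
    halfCot θ j k ^ 2 = invSinSq θ j k - 1 := by
  have := sin_half_sub_ne_zero hθ hjk
  rw [halfCot, invSinSq]
  field_simp
  linarith [Real.sin_sq_add_cos_sq ((θ j - θ k) / 2)]

theorem halfCot_mul_cyclic {n : ℕ} {θ : Fin n → ℝ} (hθ : θ ∈ chamber n) {i k l : Fin n}
    (hik : i ≠ k) (hkl : k ≠ l) (hil : i ≠ l) :
    halfCot θ i k * halfCot θ i l + halfCot θ k i * halfCot θ k l
      + halfCot θ l i * halfCot θ l k = -1 := by
  have h1 := sin_half_sub_ne_zero hθ hik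
  have h2 := sin_half_sub_ne_zero hθ hkl
  have h3 := sin_half_sub_ne_zero hθ hil
  rw [halfCot_swap θ i k, halfCot_swap θ i l, halfCot_swap θ k l]
  have e : (θ i - θ l) / 2 = (θ i - θ k) / 2 + (θ k - θ l) / 2 := by ring
  simp only [halfCot]
  rw [e] at h3 ⊢
  set x := (θ i - θ k) / 2
  set y := (θ k - θ l) / 2
  rw [Real.sin_add] at h3
  rw [Real.sin_add, Real.cos_add]
  field_simp
  ring

theorem halfCot_mul_cyclic_all {n : ℕ} {θ : Fin n → ℝ} (hθ : θ ∈ chamber n) (i k l : Fin n) :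
    halfCot θ i k * halfCot θ i l + halfCot θ k i * halfCot θ k l
      + halfCot θ l i * halfCot θ l k
    = -1 + (if i = k then invSinSq θ i l else 0) + (if k = l then invSinSq θ i k else 0)
      + (if i = l then invSinSq θ i k else 0) + (if i = k then if k = l then 1 else 0 else 0) := by
  by_cases hik : i = k
  · subst hik
    by_cases hil : i = l
    · subst hil
      simp [halfCot_self, invSinSq_self]
    · have := halfCot_sq hθ hil
      simp only [halfCot_self, halfCot_swap θ i l, hil, if_true, if_false]
      linarith
  · have := halfCot_sq hθ hik
    by_cases hil : i = l
    · subst hil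
      simp only [halfCot_self, halfCot_swap θ i k, hik, Ne.symm hik, if_true, if_false]
      linarith
    · by_cases hkl : k = l
      · subst hkl
        simp only [halfCot_self, halfCot_swap θ i k, hik, if_true, if_false]
        linarith
      · rw [halfCot_mul_cyclic hθ hik hkl hil]
        simp [hik, hil, hkl]

theorem sum_sq_sum_halfCot {n : ℕ} {θ : Fin n → ℝ} (hθ : θ ∈ chamber n) :
    ∑ i, (∑ k, halfCot θ i k) ^ 2
      = (∑ i, ∑ k, invSinSq θ i k) - (n : ℝ) * ((n : ℝ) ^ 2 - 1) / 3 := by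
  have h0 : ∑ i, (∑ k, halfCot θ i k) ^ 2
      = ∑ i, ∑ k, ∑ l, halfCot θ i k * halfCot θ i l := by
    simp only [sq, sum_mul_sum]
  have h1 : ∑ i, ∑ k, ∑ l, halfCot θ k i * halfCot θ k l
      = ∑ i, ∑ k, ∑ l, halfCot θ i k * halfCot θ i l := sum_comm
  have h2 : ∑ i, ∑ k, ∑ l, halfCot θ l i * halfCot θ l k
      = ∑ i, ∑ k, ∑ l, halfCot θ i k * halfCot θ i l := by
    rw [← h1]
    refine sum_congr rfl fun i _ => ?_
    rw [sum_comm]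
  have h3 := sum_congr rfl fun i (_ : i ∈ univ) => sum_congr rfl fun k (_ : k ∈ univ) =>
    sum_congr rfl fun l (_ : l ∈ univ) => halfCot_mul_cyclic_all hθ i k l
  simp only [sum_add_distrib] at h3
  rw [h1, h2, ← h0] at h3
  simp only [sum_ite_irrel, sum_ite_eq, sum_const_zero, sum_const, mem_univ,
    if_true, card_univ, Fintype.card_fin, nsmul_eq_mul] at h3
  linarith

theorem sum_sum_lt {n : ℕ} (f : Fin n → Fin n → ℝ) (hs : ∀ j k, f k j = f j k)
    (h0 : ∀ j, f j j = 0) :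
    ∑ j, ∑ k ∈ univ.filter (fun k => j < k), f j k = (∑ j, ∑ k, f j k) / 2 := by
  have h1 : ∑ j, ∑ k ∈ univ.filter (fun k => j < k), f j k
      = ∑ j, ∑ k ∈ univ.filter (fun k => k < j), f j k := by
    simp only [sum_filter]
    rw [sum_comm]
    simp only [hs]
  have h2 : ∑ j, ∑ k, f j k = ∑ j, ∑ k ∈ univ.filter (fun k => j < k), f j k
      + ∑ j, ∑ k ∈ univ.filter (fun k => k < j), f j k := by
    simp only [sum_filter, ← sum_add_distrib]
    refine sum_congr rfl fun j _ => sum_congr rfl fun k _ => ?_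
    rcases lt_trichotomy j k with h | h | h
    · simp [h, h.not_gt]
    · subst h; simp [h0]
    · simp [h, h.not_gt]
  linarith

theorem pd_mul {n : ℕ} {j : Fin n} {f g : (Fin n → ℝ) → ℝ} {θ : Fin n → ℝ}
    (hf : DifferentiableAt ℝ f θ) (hg : DifferentiableAt ℝ g θ) :
    pd n j (fun t => f t * g t) θ = pd n j f θ * g θ + f θ * pd n j g θ := by
  rw [pd, fderiv_fun_mul hf hg]
  simp [pd]
  ring

theorem pd_add {n : ℕ} {j : Fin n} {f g : (Fin n → ℝ) → ℝ} {θ : Fin n → ℝ}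
    (hf : DifferentiableAt ℝ f θ) (hg : DifferentiableAt ℝ g θ) :
    pd n j (fun t => f t + g t) θ = pd n j f θ + pd n j g θ := by
  rw [pd, fderiv_fun_add hf hg]
  simp [pd]

theorem pd_congr {n : ℕ} {j : Fin n} {f g : (Fin n → ℝ) → ℝ} {θ : Fin n → ℝ}
    (hθ : θ ∈ chamber n) (h : ∀ t ∈ chamber n, f t = g t) : pd n j f θ = pd n j g θ := by
  rw [pd, pd, Filter.EventuallyEq.fderiv_eq]
  filter_upwards [(isOpen_chamber n).mem_nhds hθ] with t ht using h t ht

/-- The differential of the half difference `(θ_j - θ_k) / 2`. -/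
noncomputable def halfSub (n : ℕ) (j k : Fin n) : (Fin n → ℝ) →L[ℝ] ℝ :=
  (2⁻¹ : ℝ) • ((ContinuousLinearMap.proj j : (Fin n → ℝ) →L[ℝ] ℝ) - ContinuousLinearMap.proj k)

theorem halfSub_single (n : ℕ) (j k i : Fin n) :
    halfSub n j k (Pi.single i 1) = ((if j = i then 1 else 0) - (if k = i then 1 else 0)) / 2 := by
  simp [halfSub, Pi.single_apply]
  ring

theorem hasFDerivAt_half_sub {n : ℕ} (θ : Fin n → ℝ) (j k : Fin n) :
    HasFDerivAt (fun t : Fin n → ℝ => (t j - t k) / 2) (halfSub n j k) θ := by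
  have h := (halfSub n j k).hasFDerivAt (x := θ)
  refine h.congr_of_eventuallyEq (Filter.Eventually.of_forall fun t => ?_)
  simp [halfSub]
  ring

theorem hasFDerivAt_log_sin {n : ℕ} {θ : Fin n → ℝ} (hθ : θ ∈ chamber n) (j k : Fin n) :
    HasFDerivAt (fun t : Fin n → ℝ => Real.log (Real.sin ((t j - t k) / 2)))
      (halfCot θ j k • halfSub n j k) θ := by
  by_cases hjk : j = k
  · subst hjk
    simpa [halfCot_self] using hasFDerivAt_const (0 : ℝ) θ
  · have hs := sin_half_sub_ne_zero hθ hjk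
    have h := ((Real.hasDerivAt_sin _).log hs).comp_hasFDerivAt θ (hasFDerivAt_half_sub θ j k)
    exact h

theorem hasFDerivAt_halfCot {n : ℕ} {θ : Fin n → ℝ} (hθ : θ ∈ chamber n) (j k : Fin n) :
    HasFDerivAt (fun t : Fin n → ℝ => halfCot t j k)
      ((-invSinSq θ j k) • halfSub n j k) θ := by
  by_cases hjk : j = k
  · subst hjk
    simpa [halfCot_self, invSinSq_self] using hasFDerivAt_const (0 : ℝ) θ
  · have hs := sin_half_sub_ne_zero hθ hjk
    have h := ((Real.hasDerivAt_cos _).div (Real.hasDerivAt_sin _) hs).comp_hasFDerivAt θ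
      (hasFDerivAt_half_sub θ j k)
    have e : -invSinSq θ j k = (-Real.sin ((θ j - θ k) / 2) * Real.sin ((θ j - θ k) / 2)
        - Real.cos ((θ j - θ k) / 2) * Real.cos ((θ j - θ k) / 2))
          / Real.sin ((θ j - θ k) / 2) ^ 2 := by
      rw [invSinSq, ← Real.sin_sq_add_cos_sq ((θ j - θ k) / 2)]
      ring
    rw [e]
    exact h

theorem hasFDerivAt_sum_halfCot {n : ℕ} {θ : Fin n → ℝ} (hθ : θ ∈ chamber n) (i : Fin n) :
    HasFDerivAt (fun t : Fin n → ℝ => ∑ k, halfCot t i k)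
      (∑ k, (-invSinSq θ i k) • halfSub n i k) θ :=
  HasFDerivAt.fun_sum fun k _ => hasFDerivAt_halfCot hθ i k

theorem pd_sum_halfCot {n : ℕ} {θ : Fin n → ℝ} (hθ : θ ∈ chamber n) (i : Fin n) :
    pd n i (fun t => ∑ k, halfCot t i k) θ = -(∑ k, invSinSq θ i k) / 2 := by
  rw [pd, (hasFDerivAt_sum_halfCot hθ i).fderiv]
  simp only [_root_.sum_apply, smul_apply, halfSub_single,
    smul_eq_mul, if_true]
  rw [← sum_neg_distrib, sum_div]
  refine sum_congr rfl fun k _ => ?_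
  by_cases h : k = i
  · subst h; simp [invSinSq_self]
  · simp [h]; ring

/-- The logarithm of `1 / Φ`, as a sum over ordered pairs. -/
noncomputable def logInvPhi (n : ℕ) (κ : ℝ) (θ : Fin n → ℝ) : ℝ :=
  κ⁻¹ * ∑ j, ∑ k, Real.log (Real.sin ((θ j - θ k) / 2))

theorem inv_PhiCS_eq_exp {n : ℕ} (κ : ℝ) {θ : Fin n → ℝ} (hθ : θ ∈ chamber n) :
    (PhiCS n κ θ)⁻¹ = Real.exp (logInvPhi n κ θ) := by
  have h : PhiCS n κ θ = Real.exp (∑ j, ∑ k ∈ univ.filter (fun k => j < k),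
      Real.log (Real.sin ((θ j - θ k) / 2)) * (-2 / κ)) := by
    simp only [PhiCS, Real.exp_sum]
    refine prod_congr rfl fun j _ => prod_congr rfl fun k hk => ?_
    have hjk : j ≠ k := (mem_filter.1 hk).2.ne
    rw [Real.rpow_def_of_pos (abs_pos.2 (sin_half_sub_ne_zero hθ hjk)), Real.log_abs]
  rw [h, ← Real.exp_neg, logInvPhi]
  simp only [← sum_mul]
  rw [sum_sum_lt (fun j k => Real.log (Real.sin ((θ j - θ k) / 2)))
    (fun j k => by rw [sin_half_sub_swap, Real.log_neg_eq_log]) (fun j => by simp)]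
  congr 1
  ring

theorem hasFDerivAt_logInvPhi {n : ℕ} (κ : ℝ) {θ : Fin n → ℝ} (hθ : θ ∈ chamber n) :
    HasFDerivAt (logInvPhi n κ) (κ⁻¹ • ∑ j, ∑ k, halfCot θ j k • halfSub n j k) θ :=
  (HasFDerivAt.fun_sum fun j _ => HasFDerivAt.fun_sum fun k _ =>
    hasFDerivAt_log_sin hθ j k).const_mul κ⁻¹

theorem pd_exp_logInvPhi {n : ℕ} (κ : ℝ) {θ : Fin n → ℝ} (hθ : θ ∈ chamber n) (i : Fin n) :
    pd n i (fun t => Real.exp (logInvPhi n κ t)) θ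
      = κ⁻¹ * (∑ k, halfCot θ i k) * Real.exp (logInvPhi n κ θ) := by
  rw [pd, (hasFDerivAt_logInvPhi κ hθ).exp.fderiv]
  have h : ∑ j, ∑ k, halfCot θ j k * (((if j = i then 1 else 0) - (if k = i then 1 else 0)) / 2)
      = ∑ k, halfCot θ i k := by
    have e : ∀ j k, halfCot θ j k * (((if j = i then 1 else 0) - (if k = i then 1 else 0)) / 2)
        = (if j = i then halfCot θ j k / 2 else 0) - (if k = i then halfCot θ j k / 2 else 0) := by
      intro j k
      split_ifs <;> ring
    simp only [e, sum_sub_distrib, sum_ite_irrel, sum_const_zero, sum_ite_eq', mem_univ, if_true]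
    rw [← sum_sub_distrib]
    refine sum_congr rfl fun k _ => ?_
    rw [halfCot_swap θ i k]
    ring
  simp only [_root_.sum_apply, smul_apply, halfSub_single,
    smul_eq_mul, h]
  ring

theorem differentiableAt_exp_logInvPhi {n : ℕ} (κ : ℝ) {θ : Fin n → ℝ} (hθ : θ ∈ chamber n) :
    DifferentiableAt ℝ (fun t => Real.exp (logInvPhi n κ t)) θ :=
  (hasFDerivAt_logInvPhi κ hθ).exp.differentiableAt

theorem differentiableAt_pd {n : ℕ} {Z : (Fin n → ℝ) → ℝ} (hZ : ContDiffOn ℝ 2 Z (chamber n))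
    (j : Fin n) {θ : Fin n → ℝ} (hθ : θ ∈ chamber n) : DifferentiableAt ℝ (pd n j Z) θ := by
  have h : ContDiffAt ℝ 1 (fderiv ℝ Z) θ :=
    (hZ.contDiffAt ((isOpen_chamber n).mem_nhds hθ)).fderiv_right (by norm_num)
  exact (h.differentiableAt (by norm_num)).clm_apply (differentiableAt_const _)

theorem pd_pd_div_PhiCS {n : ℕ} (κ : ℝ) {Z : (Fin n → ℝ) → ℝ}
    (hZ : ContDiffOn ℝ 2 Z (chamber n)) (j : Fin n) {θ : Fin n → ℝ} (hθ : θ ∈ chamber n) :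
    pd n j (pd n j fun t => Z t / PhiCS n κ t) θ
      = (pd n j (pd n j Z) θ + 2 * κ⁻¹ * (∑ k, halfCot θ j k) * pd n j Z θ
          + (κ⁻¹ ^ 2 * (∑ k, halfCot θ j k) ^ 2 - κ⁻¹ / 2 * ∑ k, invSinSq θ j k) * Z θ)
        * (PhiCS n κ θ)⁻¹ := by
  have dZ : ∀ t ∈ chamber n, DifferentiableAt ℝ Z t := fun t ht =>
    (hZ.contDiffAt ((isOpen_chamber n).mem_nhds ht)).differentiableAt (by norm_num)
  have first : ∀ t ∈ chamber n, pd n j (fun t => Z t / PhiCS n κ t) t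
      = (pd n j Z t + Z t * (κ⁻¹ * ∑ k, halfCot t j k)) * Real.exp (logInvPhi n κ t) := by
    intro t ht
    rw [pd_congr (g := fun t => Z t * Real.exp (logInvPhi n κ t)) ht
      fun s hs => by rw [div_eq_mul_inv, inv_PhiCS_eq_exp κ hs],
      pd_mul (dZ t ht) (differentiableAt_exp_logInvPhi κ ht), pd_exp_logInvPhi κ ht]
    ring
  have dS : DifferentiableAt ℝ (fun t : Fin n → ℝ => ∑ k, halfCot t j k) θ :=
    (hasFDerivAt_sum_halfCot hθ j).differentiableAt
  have pdS : pd n j (fun t : Fin n → ℝ => κ⁻¹ * ∑ k, halfCot t j k) θ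
      = κ⁻¹ * (-(∑ k, invSinSq θ j k) / 2) := by
    rw [← pd_sum_halfCot hθ, pd, fderiv_const_mul dS]
    rfl
  have dZS := (dZ θ hθ).fun_mul (dS.const_mul κ⁻¹)
  rw [pd_congr hθ first, pd_mul ((differentiableAt_pd hZ j hθ).fun_add dZS)
    (differentiableAt_exp_logInvPhi κ hθ), pd_add (differentiableAt_pd hZ j hθ) dZS,
    pd_mul (dZ θ hθ) (dS.const_mul κ⁻¹), pdS, pd_exp_logInvPhi κ hθ, inv_PhiCS_eq_exp κ hθ]
  ring

theorem Lop_eq {n : ℕ} (κ : ℝ) (j : Fin n) (Z : (Fin n → ℝ) → ℝ) (θ : Fin n → ℝ) :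
    Lop n κ j Z θ = κ / 2 * pd n j (pd n j Z) θ + ∑ k, halfCot θ k j * pd n k Z θ
      - (6 - κ) / (4 * κ) * Z θ * ∑ k, invSinSq θ j k := by
  rw [Lop, add_sub_assoc, mul_sum, ← sum_sub_distrib, sum_filter]
  congr 1
  refine sum_congr rfl fun k _ => ?_
  by_cases h : k = j
  · subst h; simp [halfCot_self, invSinSq_self]
  · rw [if_pos h, ← invSinSq_swap θ j k, halfCot, invSinSq]
    ring

theorem sum_Lop {n : ℕ} (κ : ℝ) (Z : (Fin n → ℝ) → ℝ) (θ : Fin n → ℝ) :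
    ∑ j, Lop n κ j Z θ = κ / 2 * ∑ j, pd n j (pd n j Z) θ
      + ∑ j, (∑ k, halfCot θ j k) * pd n j Z θ
      - (6 - κ) / (4 * κ) * Z θ * ∑ j, ∑ k, invSinSq θ j k := by
  simp only [Lop_eq, sum_sub_distrib, sum_add_distrib, ← mul_sum, sum_mul]
  rw [sum_comm]

theorem Hcs_eq {n : ℕ} (β : ℝ) (ψ : (Fin n → ℝ) → ℝ) (θ : Fin n → ℝ) :
    Hcs n β ψ θ = (1 / 2) * ∑ j, pd n j (pd n j ψ) θ
      - β * (β - 2) / 32 * ψ θ * ∑ j, ∑ k, invSinSq θ j k := by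
  have h : ∑ j, ∑ k ∈ univ.filter (fun k => j < k), ψ θ / Real.sin ((θ j - θ k) / 2) ^ 2
      = ψ θ * ((∑ j, ∑ k, invSinSq θ j k) / 2) := by
    rw [← sum_sum_lt (invSinSq θ) (invSinSq_swap θ) (invSinSq_self θ)]
    simp only [mul_sum, invSinSq, mul_one_div]
  rw [Hcs, h, ← mul_sum]
  ring

theorem stmt8 (κ : ℝ) (hκ : 0 < κ) (n : ℕ) (hn : 1 ≤ n) (h : ℝ)
    (Z : (Fin n → ℝ) → ℝ) (hZ : ContDiffOn ℝ 2 Z (chamber n))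
    (hnv : ∀ j : Fin n, ∀ θ ∈ chamber n, Lop n κ j Z θ = h * Z θ) :
    ∀ θ ∈ chamber n,
      Hcs n (8 / κ) (fun t => Z t / PhiCS n κ t) θ
        = (((n : ℝ) * h - (n : ℝ) * ((n : ℝ) ^ 2 - 1) / (6 * κ)) / κ)
            * (Z θ / PhiCS n κ θ) := by
  intro θ hθ
  have hk : κ ≠ 0 := hκ.ne'
  have hsum := sum_Lop κ Z θ
  rw [sum_congr rfl fun j _ => hnv j θ hθ, sum_const, card_univ, Fintype.card_fin,
    nsmul_eq_mul] at hsum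
  have hH := Hcs_eq (8 / κ) (fun t => Z t / PhiCS n κ t) θ
  simp only [pd_pd_div_PhiCS κ hZ _ hθ] at hH
  rw [← sum_mul, sum_add_distrib, sum_add_distrib, ← sum_mul, sum_sub_distrib, ← mul_sum,
    ← mul_sum, sum_sq_sum_halfCot hθ] at hH
  have e : ∑ j, 2 * κ⁻¹ * (∑ k, halfCot θ j k) * pd n j Z θ
      = 2 * κ⁻¹ * ∑ j, (∑ k, halfCot θ j k) * pd n j Z θ := by
    rw [mul_sum]
    exact sum_congr rfl fun j _ => by ring
  have hD : ∑ j, pd n j (pd n j Z) θ = 2 / κ * (n * (h * Z θ)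
      - ∑ j, (∑ k, halfCot θ j k) * pd n j Z θ
      + (6 - κ) / (4 * κ) * Z θ * ∑ j, ∑ k, invSinSq θ j k) := by
    rw [hsum]
    field_simp
    ring
  rw [hH, e, hD, div_eq_mul_inv (Z θ)]
  generalize (PhiCS n κ θ)⁻¹ = W
  field_simp
  ring
end

section
/- Fix n ≥ 1, a real number h, real numbers θ_1,…,θ_n with sin((θ_j−θ_k)/2) ≠ 0 for all j ≠ k, and real numbers U_1,…,U_n. Write f_{jk} = cot((θ_j−θ_k)/2) and F_j = Σ_{k≠j} f_{jk}, and set p_j = U_j + F_j. Suppose that for a fixed index j the null vector equation holds: (1/2)U_j^2 + Σ_{k≠j} cot((θ_k−θ_j)/2)·U_k − Σ_{k≠j} 3/(2 sin^2((θ_j−θ_k)/2)) = h. Then the null vector Hamiltonian H_j = (1/2)p_j^2 − Σ_{k≠j}(p_j+p_k)f_{jk} + Σ_{k≠j}Σ_{l≠j, l≠k} f_{jk}f_{jl} − 2Σ_{k≠j} f_{jk}^2 satisfies H_j = h + 3(n−1)/2 − (n−1)(n−2)/2. -/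
open Finset

/-- `f_{jk}(θ) = cot((θ_j − θ_k)/2)`. -/
noncomputable def fjk (n : ℕ) (θ : Fin n → ℝ) (j k : Fin n) : ℝ :=
  Real.cos ((θ j - θ k) / 2) / Real.sin ((θ j - θ k) / 2)

/-- The momentum `p_j = U_j + Σ_{k≠j} f_{jk}`. -/
noncomputable def pmom (n : ℕ) (θ U : Fin n → ℝ) (j : Fin n) : ℝ :=
  U j + ∑ k ∈ univ.filter (fun k => k ≠ j), fjk n θ j k

theorem fjk_self (n : ℕ) (θ : Fin n → ℝ) (j : Fin n) : fjk n θ j j = 0 := by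
  simp [fjk]

theorem fjk_swap (n : ℕ) (θ : Fin n → ℝ) (j k : Fin n) : fjk n θ k j = -fjk n θ j k := by
  have e : (θ k - θ j) / 2 = -((θ j - θ k) / 2) := by ring
  rw [fjk, fjk, e, Real.cos_neg, Real.sin_neg, div_neg]

/-- The subtraction formula for the cotangent. -/
theorem fjk_mul_sub (n : ℕ) (θ : Fin n → ℝ) (j k l : Fin n)
    (hjk : Real.sin ((θ j - θ k) / 2) ≠ 0) (hjl : Real.sin ((θ j - θ l) / 2) ≠ 0)
    (hkl : Real.sin ((θ k - θ l) / 2) ≠ 0) :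
    fjk n θ k l * (fjk n θ j k - fjk n θ j l) = fjk n θ j k * fjk n θ j l + 1 := by
  have e : (θ k - θ l) / 2 = (θ j - θ l) / 2 - (θ j - θ k) / 2 := by ring
  unfold fjk
  rw [e] at hkl ⊢
  generalize (θ j - θ l) / 2 = b at *
  generalize (θ j - θ k) / 2 = a at *
  have hsub : Real.cos a / Real.sin a - Real.cos b / Real.sin b
      = Real.sin (b - a) / (Real.sin a * Real.sin b) := by
    rw [div_sub_div _ _ hjk hjl, Real.sin_sub]
    ring
  rw [hsub, div_mul_div_cancel₀ hkl, Real.cos_sub]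
  field_simp

/-- The sum of the cotangent subtraction formula over all pairs of indices in `s`. -/
theorem two_mul_sum_fjk_mul_fjk (n : ℕ) (θ : Fin n → ℝ)
    (hθ : ∀ j k : Fin n, j ≠ k → Real.sin ((θ j - θ k) / 2) ≠ 0)
    (j : Fin n) (s : Finset (Fin n)) (hs : j ∉ s) :
    2 * ∑ k ∈ s, ∑ l ∈ s, fjk n θ k l * fjk n θ j k
      = (∑ k ∈ s, fjk n θ j k) ^ 2 - ∑ k ∈ s, fjk n θ j k ^ 2 + (#s : ℝ) ^ 2 - #s := by
  have hne : ∀ k ∈ s, j ≠ k := fun k hk e => hs (e ▸ hk)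
  have hsymm : 2 * ∑ k ∈ s, ∑ l ∈ s, fjk n θ k l * fjk n θ j k
      = ∑ k ∈ s, ∑ l ∈ s, fjk n θ k l * (fjk n θ j k - fjk n θ j l) := by
    have hcomm : ∑ k ∈ s, ∑ l ∈ s, fjk n θ k l * fjk n θ j l
        = -∑ k ∈ s, ∑ l ∈ s, fjk n θ k l * fjk n θ j k := by
      rw [sum_comm]
      simp_rw [← sum_neg_distrib]
      refine sum_congr rfl fun k _ => sum_congr rfl fun l _ => ?_
      rw [fjk_swap n θ k l]
      ring
    simp_rw [mul_sub, sum_sub_distrib]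
    rw [hcomm]
    ring
  have hpair : ∀ k ∈ s, ∀ l ∈ s, fjk n θ k l * (fjk n θ j k - fjk n θ j l)
      = fjk n θ j k * fjk n θ j l + 1 - if k = l then fjk n θ j k ^ 2 + 1 else 0 := by
    intro k hk l hl
    split_ifs with hkl
    · subst hkl
      ring
    · rw [fjk_mul_sub n θ j k l (hθ _ _ (hne k hk)) (hθ _ _ (hne l hl)) (hθ _ _ hkl), sub_zero]
  rw [hsymm, sum_congr rfl fun k hk => sum_congr rfl (hpair k hk)]
  simp_rw [sum_sub_distrib, sum_add_distrib, ← mul_sum, ← sum_mul, sum_ite_eq]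
  rw [sum_ite_mem, inter_self, sum_add_distrib]
  simp only [sum_const, nsmul_eq_mul, mul_one]
  ring

theorem stmt11 (n : ℕ) (hn : 1 ≤ n) (h : ℝ)
    (θ U : Fin n → ℝ)
    (hθ : ∀ j k : Fin n, j ≠ k → Real.sin ((θ j - θ k) / 2) ≠ 0)
    (j : Fin n)
    (hnv : (1 / 2) * U j ^ 2
        + ∑ k ∈ univ.filter (fun k => k ≠ j),
            Real.cos ((θ k - θ j) / 2) / Real.sin ((θ k - θ j) / 2) * U k
        - ∑ k ∈ univ.filter (fun k => k ≠ j),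
            3 / (2 * Real.sin ((θ j - θ k) / 2) ^ 2) = h) :
    (1 / 2) * pmom n θ U j ^ 2
      - ∑ k ∈ univ.filter (fun k => k ≠ j), (pmom n θ U j + pmom n θ U k) * fjk n θ j k
      + ∑ k ∈ univ.filter (fun k => k ≠ j),
          ∑ l ∈ univ.filter (fun l => l ≠ j ∧ l ≠ k), fjk n θ j k * fjk n θ j l
      - 2 * ∑ k ∈ univ.filter (fun k => k ≠ j), fjk n θ j k ^ 2
      = h + 3 * ((n : ℝ) - 1) / 2 - ((n : ℝ) - 1) * ((n : ℝ) - 2) / 2 := by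
  have hcot : ∀ k ∈ univ.filter (fun k => k ≠ j),
      Real.cos ((θ k - θ j) / 2) / Real.sin ((θ k - θ j) / 2) * U k
        = -(U k * fjk n θ j k) := by
    intro k _
    rw [← fjk, fjk_swap n θ j k]
    ring
  have hcsc : ∀ k ∈ univ.filter (fun k => k ≠ j),
      3 / (2 * Real.sin ((θ j - θ k) / 2) ^ 2) = 3 / 2 * (fjk n θ j k ^ 2 + 1) := by
    intro k hk
    have hsin := hθ j k (Ne.symm (mem_filter.1 hk).2)
    rw [fjk]
    field_simp
    rw [Real.cos_sq_add_sin_sq]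
  have hfilter : ∀ k, univ.filter (fun l => l ≠ j ∧ l ≠ k)
      = (univ.filter (fun l => l ≠ j)).erase k := by
    intro k
    ext l
    simp [and_comm]
  have hmom : ∀ k, pmom n θ U k
      = U k + (fjk n θ k j + ∑ l ∈ univ.filter (fun l => l ≠ j), fjk n θ k l) := by
    intro k
    rw [pmom, filter_ne', filter_ne', sum_erase _ (fjk_self n θ k),
      add_sum_erase _ _ (mem_univ j)]
  have hcard : (#(univ.filter (fun k => k ≠ j)) : ℝ) = n - 1 := by
    rw [filter_ne', card_erase_of_mem (mem_univ j), card_univ, Fintype.card_fin,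
      Nat.cast_sub hn, Nat.cast_one]
  rw [sum_congr rfl hcot, sum_congr rfl hcsc, sum_neg_distrib, ← mul_sum, sum_add_distrib,
    sum_const, nsmul_eq_mul, hcard] at hnv
  have hsum := two_mul_sum_fjk_mul_fjk n θ hθ j (univ.filter (fun k => k ≠ j)) (by simp)
  rw [hcard] at hsum
  have hcross : ∑ k ∈ univ.filter (fun k => k ≠ j),
      ∑ l ∈ univ.filter (fun l => l ≠ j ∧ l ≠ k), fjk n θ j k * fjk n θ j l
        = (∑ k ∈ univ.filter (fun k => k ≠ j), fjk n θ j k) ^ 2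
          - ∑ k ∈ univ.filter (fun k => k ≠ j), fjk n θ j k ^ 2 := by
    rw [sq, sum_mul, ← sum_sub_distrib]
    refine sum_congr rfl fun k hk => ?_
    rw [hfilter, ← mul_sum, sum_erase_eq_sub hk]
    ring
  have hmixed : ∑ k ∈ univ.filter (fun k => k ≠ j), (pmom n θ U j + pmom n θ U k) * fjk n θ j k
      = pmom n θ U j * ∑ k ∈ univ.filter (fun k => k ≠ j), fjk n θ j k
        + ∑ k ∈ univ.filter (fun k => k ≠ j), U k * fjk n θ j k
        - ∑ k ∈ univ.filter (fun k => k ≠ j), fjk n θ j k ^ 2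
        + ∑ k ∈ univ.filter (fun k => k ≠ j), ∑ l ∈ univ.filter (fun k => k ≠ j),
            fjk n θ k l * fjk n θ j k := by
    rw [mul_sum, ← sum_add_distrib, ← sum_sub_distrib, ← sum_add_distrib]
    refine sum_congr rfl fun k _ => ?_
    rw [hmom k, fjk_swap n θ j k, ← sum_mul]
    ring
  rw [hcross, hmixed, pmom]
  linear_combination hnv - hsum / 2
end
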